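/- Let u be a Q-minimizer of J on Ω. For every ε > 0 there exist constants ρ₀ = ρ₀(n,p,m,Q,λ,Λ,ε) > 0 and δ = δ(n,p,m,Q,λ,Λ,ε) > 0 such that: if |{u ≥ 0} ∩ B_ρ| ≥ ε·ρ^n for some ρ ≥ ρ₀ with B_ρ ⊆ Ω, then |{u ≥ 0} ∩ B_R| ≥ δ·R^n for every R ≥ ρ with B_R ⊆ Ω. -/

import Mathlib

open MeasureTheory Metric Set

noncomputable section

/-- `v` is locally Lipschitz at every point of `Ω`. -/
def LocLipOn {n : ℕ} (Ω : Set (EuclideanSpace ℝ (Fin n)))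
    (v : EuclideanSpace ℝ (Fin n) → ℝ) : Prop :=
  ∀ x ∈ Ω, ∃ K : NNReal, ∃ U ∈ nhds x, LipschitzOnWith K v U

/-- The Ginzburg–Landau type energy `J(v,A) = ∫_A E(∇v, v, x) dx`. -/
def Jen {n : ℕ} (Efun : EuclideanSpace ℝ (Fin n) → ℝ → EuclideanSpace ℝ (Fin n) → ℝ)
    (v : EuclideanSpace ℝ (Fin n) → ℝ) (A : Set (EuclideanSpace ℝ (Fin n))) : ℝ :=
  ∫ x in A, Efun (gradient v x) (v x) x

/-- `u` is a `Q`-minimizer of the energy `Jen Efun` in `Ω`. -/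
def IsQMin {n : ℕ} (Q : ℝ) (Ω : Set (EuclideanSpace ℝ (Fin n)))
    (Efun : EuclideanSpace ℝ (Fin n) → ℝ → EuclideanSpace ℝ (Fin n) → ℝ)
    (u : EuclideanSpace ℝ (Fin n) → ℝ) : Prop :=
  ∀ Ω' : Set (EuclideanSpace ℝ (Fin n)), IsOpen Ω' → Bornology.IsBounded Ω' →
    closure Ω' ⊆ Ω →
    ∀ v : EuclideanSpace ℝ (Fin n) → ℝ,
      (∀ x, v x ∈ Icc (-1 : ℝ) 1) → LocLipOn Ω v →
      (∀ x ∈ Ω \ Ω', v x = u x) →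
      Jen Efun u Ω' ≤ Q * Jen Efun v Ω'

/-- The radial cutoff equal to `-1` on `ball 0 (s - 1)` and to `1` outside `ball 0 s`. -/
def radialBarrier {n : ℕ} (s : ℝ) (x : EuclideanSpace ℝ (Fin n)) : ℝ :=
  -1 + 2 * max 0 (min 1 (‖x‖ - s + 1))

theorem radialBarrier_lipschitz {n : ℕ} (s : ℝ) :
    LipschitzWith 2 (radialBarrier (n := n) s) := by
  refine LipschitzWith.of_dist_le_mul fun x y => ?_
  have h1 : |max 0 (min 1 (‖x‖ - s + 1)) - max 0 (min 1 (‖y‖ - s + 1))|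
      ≤ |min 1 (‖x‖ - s + 1) - min 1 (‖y‖ - s + 1)| := by
    simpa using abs_max_sub_max_le_max 0 (min 1 (‖x‖ - s + 1)) 0 (min 1 (‖y‖ - s + 1))
  have h2 : |min 1 (‖x‖ - s + 1) - min 1 (‖y‖ - s + 1)|
      ≤ |(‖x‖ - s + 1) - (‖y‖ - s + 1)| := by
    simpa using abs_min_sub_min_le_max 1 (‖x‖ - s + 1) 1 (‖y‖ - s + 1)
  have h3 : |(‖x‖ - s + 1) - (‖y‖ - s + 1)| ≤ dist x y := by
    have : (‖x‖ - s + 1) - (‖y‖ - s + 1) = ‖x‖ - ‖y‖ := by ring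
    rw [this, dist_eq_norm]
    exact abs_norm_sub_norm_le x y
  rw [Real.dist_eq]
  have : radialBarrier s x - radialBarrier s y
      = 2 * (max 0 (min 1 (‖x‖ - s + 1)) - max 0 (min 1 (‖y‖ - s + 1))) := by
    unfold radialBarrier; ring
  rw [this, abs_mul, abs_two]
  push_cast
  linarith

theorem radialBarrier_mem_Icc {n : ℕ} (s : ℝ) (x : EuclideanSpace ℝ (Fin n)) :
    radialBarrier s x ∈ Icc (-1 : ℝ) 1 := by
  have h0 : 0 ≤ max 0 (min 1 (‖x‖ - s + 1)) := le_max_left _ _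
  have h1 : max 0 (min 1 (‖x‖ - s + 1)) ≤ 1 := max_le zero_le_one (min_le_left _ _)
  constructor <;> unfold radialBarrier <;> linarith

theorem radialBarrier_of_le {n : ℕ} {s : ℝ} {x : EuclideanSpace ℝ (Fin n)} (h : s ≤ ‖x‖) :
    radialBarrier s x = 1 := by
  rw [radialBarrier, min_eq_left (by linarith), max_eq_right zero_le_one]; norm_num

theorem radialBarrier_of_le_sub_one {n : ℕ} {s : ℝ} {x : EuclideanSpace ℝ (Fin n)} (h : ‖x‖ ≤ s - 1) :
    radialBarrier s x = -1 := by
  rw [radialBarrier, max_eq_left ((min_le_right _ _).trans (by linarith))]; norm_num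

theorem norm_gradient {n : ℕ} (f : EuclideanSpace ℝ (Fin n) → ℝ) (x : EuclideanSpace ℝ (Fin n)) :
    ‖gradient f x‖ = ‖fderiv ℝ f x‖ := by
  rw [gradient, LinearIsometryEquiv.norm_map]

theorem measurable_gradient {n : ℕ} (f : EuclideanSpace ℝ (Fin n) → ℝ) :
    Measurable (gradient f) :=
  (LinearIsometryEquiv.continuous _).measurable.comp (measurable_fderiv ℝ f)

theorem LocLipOn.continuousOn {n : ℕ} {Ω : Set (EuclideanSpace ℝ (Fin n))}
    {v : EuclideanSpace ℝ (Fin n) → ℝ} (h : LocLipOn Ω v) : ContinuousOn v Ω := by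
  intro x hx
  obtain ⟨K, U, hU, hK⟩ := h x hx
  exact (hK.continuousOn.continuousAt hU).continuousWithinAt

theorem LocLipOn.min_lipschitz {n : ℕ} {Ω : Set (EuclideanSpace ℝ (Fin n))}
    {v w : EuclideanSpace ℝ (Fin n) → ℝ} {C : NNReal} (h : LocLipOn Ω v) (hw : LipschitzWith C w) :
    LocLipOn Ω fun x => min (v x) (w x) := by
  intro x hx
  obtain ⟨K, U, hU, hK⟩ := h x hx
  refine ⟨max K C, U, hU, LipschitzOnWith.of_dist_le_mul fun y hy z hz => ?_⟩
  have h1 := hK.dist_le_mul y hy z hz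
  have h2 := hw.dist_le_mul y z
  rw [Real.dist_eq] at *
  have h3 := abs_min_sub_min_le_max (v y) (w y) (v z) (w z)
  refine h3.trans (max_le (h1.trans ?_) (h2.trans ?_))
  · gcongr; exact le_max_left _ _
  · gcongr; exact le_max_right _ _

theorem LocLipOn.exists_lipschitz_eqOn {n : ℕ} {Ω : Set (EuclideanSpace ℝ (Fin n))}
    {v : EuclideanSpace ℝ (Fin n) → ℝ} (h : LocLipOn Ω v) {s : ℝ}
    (hs : closedBall (0 : EuclideanSpace ℝ (Fin n)) s ⊆ Ω) :
    ∃ K : NNReal, ∃ U : EuclideanSpace ℝ (Fin n) → ℝ,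
      LipschitzWith K U ∧ EqOn v U (closedBall 0 s) := by
  have hl : LocallyLipschitzOn (closedBall (0 : EuclideanSpace ℝ (Fin n)) s) v := by
    intro x hx
    obtain ⟨K, U, hU, hK⟩ := h x (hs hx)
    exact ⟨K, U, mem_nhdsWithin_of_mem_nhds hU, hK⟩
  obtain ⟨K, hK⟩ := hl.exists_lipschitzOnWith_of_compact (isCompact_closedBall 0 s)
  obtain ⟨U, hU, hUe⟩ := hK.extend_real
  exact ⟨K, U, hU, hUe⟩

theorem lintegral_superlevel_radialBarrier_le
    {n : ℕ} {p m Q lam Lam : ℝ} (hp : 1 < p) (hm : 0 < m) (hQ : 1 ≤ Q) (hlam : 0 < lam)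
    (hlL : lam ≤ Lam) {Ω : Set (EuclideanSpace ℝ (Fin n))}
    {Efun : EuclideanSpace ℝ (Fin n) → ℝ → EuclideanSpace ℝ (Fin n) → ℝ}
    (hEm : Measurable (fun q : EuclideanSpace ℝ (Fin n) × ℝ × EuclideanSpace ℝ (Fin n) =>
          Efun q.1 q.2.1 q.2.2))
    (hE : ∀ ξ τ x, τ ∈ Icc (-1 : ℝ) 1 → x ∈ Ω →
          0 ≤ Efun ξ τ x ∧ Efun ξ τ x ≤ Lam * (‖ξ‖ ^ p + |τ + 1| ^ m))
    {u : EuclideanSpace ℝ (Fin n) → ℝ} (hu : ∀ x, u x ∈ Icc (-1 : ℝ) 1)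
    (hul : LocLipOn Ω u) (hmin : IsQMin Q Ω Efun u) {s : ℝ} (hs : closedBall 0 s ⊆ Ω) :
    ∫⁻ x in {x | x ∈ ball 0 s ∧ radialBarrier s x < u x},
        ENNReal.ofReal (Efun (gradient u x) (u x) x)
      ≤ ENNReal.ofReal (Q * (Lam * (2 ^ p + 2 ^ m))) *
        volume ({x | x ∈ ball 0 s ∧ radialBarrier s x < u x} \ ball 0 (s - 1)) := by
  set W : Set (EuclideanSpace ℝ (Fin n)) := {x | x ∈ ball 0 s ∧ radialBarrier s x < u x} with hW
  have hbΩ : ball (0 : EuclideanSpace ℝ (Fin n)) s ⊆ Ω := ball_subset_closedBall.trans hs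
  have hWb : W ⊆ ball 0 s := fun x hx => hx.1
  have hWΩ : W ⊆ Ω := hWb.trans hbΩ
  have hLam : 0 < Lam := hlam.trans_le hlL
  have hucont : ContinuousOn u (ball 0 s) := hul.continuousOn.mono hbΩ
  have hWo : IsOpen W := by
    have : ContinuousOn (fun x => u x - radialBarrier s x) (ball 0 s) :=
      hucont.sub (radialBarrier_lipschitz s).continuous.continuousOn
    have h2 := this.isOpen_inter_preimage isOpen_ball (isOpen_Ioi (a := (0 : ℝ)))
    convert! h2 using 1
    ext x
    simp [hW]
  have hWm : MeasurableSet W := hWo.measurableSet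
  have hWfin : volume W < ⊤ := (measure_mono hWb).trans_lt measure_ball_lt_top
  set v : EuclideanSpace ℝ (Fin n) → ℝ := fun x => min (u x) (radialBarrier s x) with hv
  have hvI : ∀ x, v x ∈ Icc (-1 : ℝ) 1 := fun x =>
    ⟨le_min (hu x).1 (radialBarrier_mem_Icc s x).1, (min_le_left _ _).trans (hu x).2⟩
  have hvu : ∀ x ∈ Ω \ W, v x = u x := by
    intro x hx
    refine min_eq_left ?_
    by_cases hxs : x ∈ ball (0 : EuclideanSpace ℝ (Fin n)) s
    · by_contra hcon
      exact hx.2 ⟨hxs, not_le.mp hcon⟩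
    · rw [radialBarrier_of_le (by simpa using hxs)]
      exact (hu x).2
  have hJ := hmin W hWo (isBounded_ball.subset hWb)
    ((closure_mono hWb).trans (closure_ball_subset_closedBall.trans hs)) v hvI
    (hul.min_lipschitz (radialBarrier_lipschitz s)) hvu
  -- the energy of the competitor lives in the outer shell
  have hvE : Jen Efun v W ≤ Lam * (2 ^ p + 2 ^ m) * volume.real (W \ ball 0 (s - 1)) := by
    have hle : Jen Efun v W ≤
        ∫ x in W, (ball (0 : EuclideanSpace ℝ (Fin n)) (s - 1))ᶜ.indicator
          (fun _ => Lam * (2 ^ p + 2 ^ m)) x := by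
      refine integral_mono_of_nonneg ?_ ?_ ?_
      · filter_upwards [ae_restrict_mem hWm] with x hx
        exact (hE _ _ _ (hvI x) (hWΩ hx)).1
      · refine Integrable.indicator ?_ measurableSet_ball.compl
        exact integrableOn_const hWfin.ne
      · filter_upwards [ae_restrict_mem hWm] with x hx
        have hvw : v =ᶠ[nhds x] radialBarrier s := by
          filter_upwards [hWo.mem_nhds hx] with y hy
          exact min_eq_right hy.2.le
        have hfd : fderiv ℝ v x = fderiv ℝ (radialBarrier s) x := hvw.fderiv_eq
        have hEx := (hE (gradient v x) (v x) x (hvI x) (hWΩ hx)).2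
        by_cases hxb : x ∈ ball (0 : EuclideanSpace ℝ (Fin n)) (s - 1)
        · rw [indicator_of_notMem (notMem_compl_iff.mpr hxb)]
          have hc : radialBarrier s =ᶠ[nhds x] fun _ => (-1 : ℝ) := by
            filter_upwards [isOpen_ball.mem_nhds hxb] with y hy
            exact radialBarrier_of_le_sub_one (mem_ball_zero_iff.mp hy).le
          have hg : ‖gradient v x‖ = 0 := by
            rw [norm_gradient, hfd, hc.fderiv_eq]; simp
          have hvx : v x = -1 := (hvw.trans hc).eq_of_nhds
          rw [hg, hvx, Real.zero_rpow (by linarith)] at hEx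
          rw [hvx]
          simpa [Real.zero_rpow hm.ne'] using hEx
        · rw [indicator_of_mem (by simpa using hxb)]
          refine hEx.trans ?_
          have hg : ‖gradient v x‖ ≤ 2 := by
            rw [norm_gradient, hfd]
            exact norm_fderiv_le_of_lipschitz ℝ (radialBarrier_lipschitz s)
          have hvx : |v x + 1| ≤ 2 := by
            have := hvI x
            rw [abs_of_nonneg (by linarith [this.1])]; linarith [this.2]
          gcongr
    refine hle.trans ?_
    rw [integral_indicator measurableSet_ball.compl, setIntegral_const,
      measureReal_restrict_apply measurableSet_ball.compl, smul_eq_mul, mul_comm, inter_comm,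
      Set.sdiff_eq]
  obtain ⟨K, U, hUK, hUe⟩ := hul.exists_lipschitz_eqOn hs
  have hint : Integrable (fun x => Efun (gradient u x) (u x) x) (volume.restrict W) := by
    have haem : AEMeasurable u (volume.restrict W) :=
      (hucont.mono hWb).aemeasurable hWm
    have hmeas : AEMeasurable (fun x => Efun (gradient u x) (u x) x) (volume.restrict W) :=
      hEm.comp_aemeasurable
        ((measurable_gradient u).aemeasurable.prodMk (haem.prodMk aemeasurable_id))
    have hbd : Integrable (fun _ : EuclideanSpace ℝ (Fin n) => Lam * ((K : ℝ) ^ p + 2 ^ m))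
        (volume.restrict W) := integrableOn_const hWfin.ne
    refine hbd.mono' hmeas.aestronglyMeasurable ?_
    filter_upwards [ae_restrict_mem hWm] with x hx
    have hEx := hE (gradient u x) (u x) x (hu x) (hWΩ hx)
    rw [Real.norm_of_nonneg hEx.1]
    refine hEx.2.trans ?_
    have hg : ‖gradient u x‖ ≤ K := by
      have : u =ᶠ[nhds x] U := by
        filter_upwards [isOpen_ball.mem_nhds hx.1] with y hy
        exact hUe (ball_subset_closedBall hy)
      rw [norm_gradient, this.fderiv_eq]
      exact norm_fderiv_le_of_lipschitz ℝ hUK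
    have hux : |u x + 1| ≤ 2 := by
      have := hu x
      rw [abs_of_nonneg (by linarith [this.1])]; linarith [this.2]
    gcongr
  rw [← ofReal_integral_eq_lintegral_ofReal hint]
  · have hfin : volume (W \ ball 0 (s - 1)) ≠ ⊤ :=
      ((measure_mono sdiff_subset).trans_lt hWfin).ne
    rw [← ofReal_measureReal hfin, ← ENNReal.ofReal_mul (by positivity)]
    refine ENNReal.ofReal_le_ofReal (hJ.trans ?_)
    rw [mul_assoc]
    exact mul_le_mul_of_nonneg_left hvE (by linarith)
  · filter_upwards [ae_restrict_mem hWm] with x hx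
    exact (hE _ _ _ (hu x) (hWΩ hx)).1

theorem half_le_mul_lintegral_segment {n : ℕ} {U : EuclideanSpace ℝ (Fin n) → ℝ} {K : NNReal}
    (hU : LipschitzWith K U) {r : ℝ} {x h : EuclideanSpace ℝ (Fin n)}
    (hx : x ∈ ball 0 r) (hxh : x + h ∈ ball 0 r) (hUx : 0 ≤ U x) (hUxh : U (x + h) ≤ -(1 / 2))
    (hd : ∀ᵐ t : ℝ ∂volume.restrict (Ioc 0 1), DifferentiableAt ℝ U (x + t • h)) :
    ENNReal.ofReal (1 / 2) ≤ ‖h‖ₑ * ∫⁻ t : ℝ in Ioc 0 1,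
      {y | y ∈ ball 0 r ∧ -(1 / 2) < U y ∧ U y < 0}.indicator (fun y => ‖fderiv ℝ U y‖ₑ)
        (x + t • h) := by
  set φ : ℝ → ℝ := fun t => max (-(1 / 2)) (min 0 (U (x + t • h))) with hφ
  have hφl : LipschitzWith (K * ‖h‖₊) φ := by
    have h1 : LipschitzWith ‖h‖₊ fun t : ℝ => x + t • h := by
      refine LipschitzWith.of_dist_le_mul fun a b => ?_
      rw [dist_add_left, dist_eq_norm, ← sub_smul, norm_smul, Real.dist_eq, mul_comm]
      rfl
    exact ((hU.comp h1).const_min 0).const_max _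
  have hint : ∫ t in (0 : ℝ)..1, deriv φ t = -(1 / 2) := by
    rw [(hφl.lipschitzOnWith (s := uIcc 0 1)).absolutelyContinuousOnInterval.integral_deriv_eq_sub]
    have h1 : φ 1 = -(1 / 2) := by
      simp only [hφ, one_smul]
      exact max_eq_left ((min_le_right _ _).trans hUxh)
    have h0 : φ 0 = 0 := by
      simp only [hφ, zero_smul, add_zero]
      rw [min_eq_left hUx]; norm_num
    rw [h1, h0]; norm_num
  rw [intervalIntegral.integral_of_le zero_le_one] at hint
  have hle := enorm_integral_le_lintegral_enorm (μ := volume.restrict (Ioc (0 : ℝ) 1)) (deriv φ)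
  rw [hint, enorm_neg, Real.enorm_of_nonneg (by norm_num)] at hle
  refine hle.trans ?_
  rw [← lintegral_const_mul' _ _ (by simp)]
  refine lintegral_mono_ae ?_
  filter_upwards [hd, ae_restrict_mem measurableSet_Ioc] with t htd ht
  rcases le_or_gt 0 (U (x + t • h)) with h0 | h0
  · have hmax : IsLocalMax φ t := by
      refine Filter.Eventually.of_forall fun t' => ?_
      simp only [hφ]
      rw [min_eq_left h0]
      exact max_le_max le_rfl (min_le_left _ _)
    rw [hmax.deriv_eq_zero]; simp
  rcases le_or_gt (U (x + t • h)) (-(1 / 2)) with h1 | h1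
  · have hmin : IsLocalMin φ t := by
      refine Filter.Eventually.of_forall fun t' => ?_
      simp only [hφ]
      rw [max_eq_left ((min_le_right _ _).trans h1)]
      exact le_max_left _ _
    rw [hmin.deriv_eq_zero]; simp
  have hball : x + t • h ∈ ball (0 : EuclideanSpace ℝ (Fin n)) r :=
    (convex_ball 0 r).add_smul_mem hx hxh ⟨ht.1.le, ht.2⟩
  rw [indicator_of_mem (show x + t • h ∈ {y | y ∈ ball 0 r ∧ -(1 / 2) < U y ∧ U y < 0} from
    ⟨hball, h1, h0⟩)]
  have hline : HasDerivAt (fun t : ℝ => x + t • h) h t := by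
    simpa using ((hasDerivAt_id t).smul_const h).const_add x
  have hcomp : HasDerivAt (fun t : ℝ => U (x + t • h)) (fderiv ℝ U (x + t • h) h) t :=
    htd.hasFDerivAt.comp_hasDerivAt t hline
  have heq : φ =ᶠ[nhds t] fun t => U (x + t • h) := by
    have hc : ContinuousAt (fun t : ℝ => U (x + t • h)) t := hcomp.continuousAt
    filter_upwards [hc.eventually (Ioo_mem_nhds h1 h0)] with t' ht'
    simp only [hφ]
    rw [min_eq_right ht'.2.le, max_eq_right ht'.1.le]
  rw [heq.deriv_eq, hcomp.deriv, mul_comm]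
  exact (fderiv ℝ U (x + t • h)).le_opENorm h

theorem ball_half_measure_le {n : ℕ} {r t : ℝ} (ht : 0 < t) (htr : t ≤ r)
    {x : EuclideanSpace ℝ (Fin n)} (hx : x ∈ ball 0 r) :
    volume (ball (0 : EuclideanSpace ℝ (Fin n)) (t / 2))
      ≤ volume {h | h ∈ ball (0 : EuclideanSpace ℝ (Fin n)) t ∧ x + h ∈ ball 0 r} := by
  have hr : 0 < r := ht.trans_le htr
  rw [← Measure.addHaar_ball_center volume (-(t / (2 * r)) • x) (t / 2)]
  refine measure_mono fun h hh => ?_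
  rw [mem_ball_zero_iff] at hx
  rw [mem_ball_iff_norm] at hh
  have hc : t / (2 * r) ≤ 1 / 2 := by
    rw [div_le_div_iff₀ (by positivity) (by positivity)]; linarith
  have hc0 : 0 < t / (2 * r) := by positivity
  have hcr : t / (2 * r) * r = t / 2 := by field_simp
  constructor
  · rw [mem_ball_zero_iff]
    have h1 : h = (h - -(t / (2 * r)) • x) + -(t / (2 * r)) • x := by abel
    have h2 : ‖-(t / (2 * r)) • x‖ = t / (2 * r) * ‖x‖ := by
      rw [norm_smul, norm_neg, Real.norm_of_nonneg hc0.le]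
    have h3 := norm_add_le (h - -(t / (2 * r)) • x) (-(t / (2 * r)) • x)
    rw [← h1, h2] at h3
    have : t / (2 * r) * ‖x‖ < t / (2 * r) * r := by gcongr
    linarith
  · rw [mem_ball_zero_iff]
    have h1 : x + h = (h - -(t / (2 * r)) • x) + (1 - t / (2 * r)) • x := by
      rw [sub_smul, neg_smul, one_smul]; abel
    have h2 : ‖(1 - t / (2 * r)) • x‖ = (1 - t / (2 * r)) * ‖x‖ := by
      rw [norm_smul, Real.norm_of_nonneg (by linarith)]
    have h3 := norm_add_le (h - -(t / (2 * r)) • x) ((1 - t / (2 * r)) • x)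
    rw [← h1, h2] at h3
    have : (1 - t / (2 * r)) * ‖x‖ ≤ (1 - t / (2 * r)) * r :=
      mul_le_mul_of_nonneg_left hx.le (by linarith)
    linarith

theorem half_mul_volume_translate_le {n : ℕ} {U : EuclideanSpace ℝ (Fin n) → ℝ} {K : NNReal}
    (hU : LipschitzWith K U) {r : ℝ} (h : EuclideanSpace ℝ (Fin n)) :
    ENNReal.ofReal (1 / 2) *
        volume {x | x ∈ ball 0 r ∧ 0 ≤ U x ∧ x + h ∈ ball 0 r ∧ U (x + h) ≤ -(1 / 2)}
      ≤ ‖h‖ₑ * ∫⁻ y in {y | y ∈ ball 0 r ∧ -(1 / 2) < U y ∧ U y < 0}, ‖fderiv ℝ U y‖ₑ := by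
  have hUm : Measurable U := hU.continuous.measurable
  set S : Set (EuclideanSpace ℝ (Fin n)) := {y | y ∈ ball 0 r ∧ -(1 / 2) < U y ∧ U y < 0} with hS
  have hSm : MeasurableSet S :=
    measurableSet_ball.inter ((measurableSet_lt measurable_const hUm).inter
      (measurableSet_lt hUm measurable_const))
  set A : Set (EuclideanSpace ℝ (Fin n)) :=
    {x | x ∈ ball 0 r ∧ 0 ≤ U x ∧ x + h ∈ ball 0 r ∧ U (x + h) ≤ -(1 / 2)} with hA
  have hAm : MeasurableSet A := by
    have hC : MeasurableSet {y | y ∈ ball (0 : EuclideanSpace ℝ (Fin n)) r ∧ U y ≤ -(1 / 2)} :=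
      measurableSet_ball.inter (measurableSet_le hUm measurable_const)
    exact measurableSet_ball.inter ((measurableSet_le measurable_const hUm).inter
      ((measurable_add_const h) hC))
  set g : EuclideanSpace ℝ (Fin n) → ENNReal := S.indicator fun y => ‖fderiv ℝ U y‖ₑ with hg
  have hgm : Measurable g := (measurable_fderiv ℝ U).enorm.indicator hSm
  have hmap : Measurable fun z : EuclideanSpace ℝ (Fin n) × ℝ => z.1 + z.2 • h := by fun_prop
  have hd : ∀ᵐ x : EuclideanSpace ℝ (Fin n), ∀ᵐ t : ℝ ∂volume.restrict (Ioc 0 1),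
      DifferentiableAt ℝ U (x + t • h) := by
    have hms : MeasurableSet {z : EuclideanSpace ℝ (Fin n) × ℝ |
        DifferentiableAt ℝ U (z.1 + z.2 • h)} :=
      hmap (measurableSet_of_differentiableAt ℝ U)
    rw [Measure.ae_ae_comm hms]
    refine Filter.Eventually.of_forall fun t => ?_
    exact (measurePreserving_add_right volume (t • h)).quasiMeasurePreserving.ae
      hU.ae_differentiableAt
  have hswap : ∫⁻ x, ∫⁻ t : ℝ in Ioc 0 1, g (x + t • h) = ∫⁻ y in S, ‖fderiv ℝ U y‖ₑ := by
    rw [lintegral_lintegral_swap (f := fun x (t : ℝ) => g (x + t • h))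
      (hgm.comp hmap).aemeasurable]
    have : ∀ t : ℝ, ∫⁻ x, g (x + t • h) = ∫⁻ y, g y := fun t =>
      lintegral_add_right_eq_self g (t • h)
    simp only [this, lintegral_const, MeasurableSet.univ, Measure.restrict_apply, univ_inter,
      Real.volume_Ioc]
    rw [hg, lintegral_indicator hSm]
    simp
  calc ENNReal.ofReal (1 / 2) * volume A
      = ∫⁻ x in A, ENNReal.ofReal (1 / 2) := by rw [setLIntegral_const]
    _ ≤ ∫⁻ x in A, ‖h‖ₑ * ∫⁻ t : ℝ in Ioc 0 1, g (x + t • h) := by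
        refine lintegral_mono_ae ?_
        filter_upwards [ae_restrict_mem hAm, ae_restrict_of_ae hd] with x hx hxd
        exact half_le_mul_lintegral_segment hU hx.1 hx.2.2.1 hx.2.1 hx.2.2.2 hxd
    _ ≤ ∫⁻ x, ‖h‖ₑ * ∫⁻ t : ℝ in Ioc 0 1, g (x + t • h) := setLIntegral_le_lintegral _ _
    _ = ‖h‖ₑ * ∫⁻ y in S, ‖fderiv ℝ U y‖ₑ := by
        rw [lintegral_const_mul' _ _ (by simp), hswap]

/-- A relative isoperimetric inequality in a ball, at scale `t`, for Lipschitz functions. -/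
theorem relative_isoperimetric_ball {n : ℕ} {U : EuclideanSpace ℝ (Fin n) → ℝ} {K : NNReal}
    (hU : LipschitzWith K U) {r t : ℝ} (ht : 0 < t) (htr : t ≤ r) :
    ENNReal.ofReal (1 / 2) * (volume {x | x ∈ ball 0 r ∧ 0 ≤ U x} *
        (volume (ball (0 : EuclideanSpace ℝ (Fin n)) (t / 2))
          - volume {x | x ∈ ball 0 r ∧ -(1 / 2) < U x}))
      ≤ ENNReal.ofReal t * (∫⁻ y in {y | y ∈ ball 0 r ∧ -(1 / 2) < U y ∧ U y < 0},
          ‖fderiv ℝ U y‖ₑ) * volume (ball (0 : EuclideanSpace ℝ (Fin n)) t) := by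
  have hUm : Measurable U := hU.continuous.measurable
  set I := ∫⁻ y in {y | y ∈ ball 0 r ∧ -(1 / 2) < U y ∧ U y < 0}, ‖fderiv ℝ U y‖ₑ
  set P : Set (EuclideanSpace ℝ (Fin n)) := {x | x ∈ ball 0 r ∧ 0 ≤ U x} with hP
  have hPm : MeasurableSet P := measurableSet_ball.inter (measurableSet_le measurable_const hUm)
  set N : Set (EuclideanSpace ℝ (Fin n)) := {x | x ∈ ball 0 r ∧ -(1 / 2) < U x} with hN
  have hNm : MeasurableSet N := measurableSet_ball.inter (measurableSet_lt measurable_const hUm)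
  set T : Set (EuclideanSpace ℝ (Fin n) × EuclideanSpace ℝ (Fin n)) :=
    {z | z.1 ∈ P ∧ z.2 ∈ ball 0 t ∧ z.1 + z.2 ∈ ball 0 r ∧ U (z.1 + z.2) ≤ -(1 / 2)} with hT
  have hadd : Measurable fun z : EuclideanSpace ℝ (Fin n) × EuclideanSpace ℝ (Fin n) =>
    z.1 + z.2 := by fun_prop
  have hTm : MeasurableSet T := by
    have hC : MeasurableSet {y | y ∈ ball (0 : EuclideanSpace ℝ (Fin n)) r ∧ U y ≤ -(1 / 2)} :=
      measurableSet_ball.inter (measurableSet_le hUm measurable_const)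
    exact (measurable_fst hPm).inter ((measurable_snd measurableSet_ball).inter (hadd hC))
  have hlower : volume P * (volume (ball (0 : EuclideanSpace ℝ (Fin n)) (t / 2)) - volume N)
      ≤ (volume.prod volume) T := by
    rw [Measure.prod_apply hTm, mul_comm, ← setLIntegral_const]
    refine (setLIntegral_mono' hPm fun x hx => ?_).trans (setLIntegral_le_lintegral P _)
    rw [tsub_le_iff_right]
    refine (ball_half_measure_le ht htr hx.1).trans ?_
    have hNx : volume ((fun h => x + h) ⁻¹' N) = volume N := measure_preimage_add volume x N
    rw [← hNx]
    refine (measure_mono fun h hh => ?_).trans (measure_union_le _ _)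
    by_cases hc : U (x + h) ≤ -(1 / 2)
    · exact Or.inl ⟨hx, hh.1, hh.2, hc⟩
    · exact Or.inr ⟨hh.2, not_le.mp hc⟩
  have hupper : ENNReal.ofReal (1 / 2) * (volume.prod volume) T
      ≤ ENNReal.ofReal t * I * volume (ball (0 : EuclideanSpace ℝ (Fin n)) t) := by
    rw [Measure.prod_apply_symm hTm, ← lintegral_const_mul' _ _ (by simp), ← setLIntegral_const,
      ← lintegral_indicator measurableSet_ball]
    refine lintegral_mono fun h => ?_
    by_cases hh : h ∈ ball (0 : EuclideanSpace ℝ (Fin n)) t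
    · rw [indicator_of_mem hh]
      have hn : ‖h‖ₑ ≤ ENNReal.ofReal t := by
        rw [← ofReal_norm]
        exact ENNReal.ofReal_le_ofReal (mem_ball_zero_iff.mp hh).le
      refine le_trans ?_ ((half_mul_volume_translate_le hU (r := r) h).trans (by gcongr))
      gcongr
      exact fun x hx => ⟨hx.1.1, hx.1.2, hx.2.2.1, hx.2.2.2⟩
    · rw [indicator_of_notMem hh]
      have : (fun x => (x, h)) ⁻¹' T = ∅ := by
        ext x
        simp only [mem_preimage, mem_empty_iff_false, iff_false]
        exact fun hx => hh hx.2.1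
      rw [this]; simp
  exact (mul_le_mul_right hlower _).trans hupper

theorem LocLipOn.relative_isoperimetric_ball {n : ℕ} {Ω : Set (EuclideanSpace ℝ (Fin n))}
    {u : EuclideanSpace ℝ (Fin n) → ℝ} (hul : LocLipOn Ω u) {r t : ℝ} (hr : closedBall 0 r ⊆ Ω)
    (ht : 0 < t) (htr : t ≤ r) :
    ENNReal.ofReal (1 / 2) * (volume {x | x ∈ ball 0 r ∧ 0 ≤ u x} *
        (volume (ball (0 : EuclideanSpace ℝ (Fin n)) (t / 2))
          - volume {x | x ∈ ball 0 r ∧ -(1 / 2) < u x}))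
      ≤ ENNReal.ofReal t * (∫⁻ y in {y | y ∈ ball 0 r ∧ -(1 / 2) < u y ∧ u y < 0},
          ‖fderiv ℝ u y‖ₑ) * volume (ball (0 : EuclideanSpace ℝ (Fin n)) t) := by
  obtain ⟨K, U, hUK, hUe⟩ := hul.exists_lipschitz_eqOn hr
  have heq : EqOn u U (ball 0 r) := hUe.mono ball_subset_closedBall
  have hUm : Measurable U := hUK.continuous.measurable
  have h1 : {x | x ∈ ball 0 r ∧ 0 ≤ u x} = {x | x ∈ ball 0 r ∧ 0 ≤ U x} := by
    ext x
    exact and_congr_right fun hx => by rw [heq hx]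
  have h2 : {x | x ∈ ball 0 r ∧ -(1 / 2) < u x} = {x | x ∈ ball 0 r ∧ -(1 / 2) < U x} := by
    ext x
    exact and_congr_right fun hx => by rw [heq hx]
  have h3 : {y | y ∈ ball 0 r ∧ -(1 / 2) < u y ∧ u y < 0}
      = {y | y ∈ ball 0 r ∧ -(1 / 2) < U y ∧ U y < 0} := by
    ext x
    exact and_congr_right fun hx => by rw [heq hx]
  rw [h1, h2, h3]
  have h4 : ∫⁻ y in {y | y ∈ ball 0 r ∧ -(1 / 2) < U y ∧ U y < 0}, ‖fderiv ℝ u y‖ₑ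
      = ∫⁻ y in {y | y ∈ ball 0 r ∧ -(1 / 2) < U y ∧ U y < 0}, ‖fderiv ℝ U y‖ₑ := by
    refine setLIntegral_congr_fun (measurableSet_ball.inter
      ((measurableSet_lt measurable_const hUm).inter
        (measurableSet_lt hUm measurable_const))) fun y hy => ?_
    have : u =ᶠ[nhds y] U := heq.eventuallyEq_of_mem (isOpen_ball.mem_nhds hy.1)
    simp only [this.fderiv_eq]
  rw [h4]
  exact _root_.relative_isoperimetric_ball hUK ht htr

theorem pow_sub_pow_le_mul {x y : ℝ} (hy : 0 ≤ y) (hyx : y ≤ x) (k : ℕ) :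
    x ^ (k + 1) - y ^ (k + 1) ≤ (k + 1) * (x - y) * x ^ k := by
  induction k with
  | zero => simp
  | succ k ih =>
    have hx : 0 ≤ x := hy.trans hyx
    have h1 : y ^ (k + 1) ≤ x ^ (k + 1) := by gcongr
    have h2 := mul_le_mul_of_nonneg_left ih hx
    have h3 := mul_le_mul_of_nonneg_left h1 (sub_nonneg.mpr hyx)
    push_cast
    calc x ^ (k + 1 + 1) - y ^ (k + 1 + 1)
        = x * (x ^ (k + 1) - y ^ (k + 1)) + (x - y) * y ^ (k + 1) := by ring
      _ ≤ x * ((k + 1) * (x - y) * x ^ k) + (x - y) * x ^ (k + 1) := add_le_add h2 h3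
      _ = (k + 1 + 1) * (x - y) * x ^ (k + 1) := by ring

theorem volume_real_ball_zero {n : ℕ} (hn : n ≠ 0) {r : ℝ} (hr : 0 ≤ r) :
    volume.real (ball (0 : EuclideanSpace ℝ (Fin n)) r)
      = r ^ n * volume.real (ball (0 : EuclideanSpace ℝ (Fin n)) 1) := by
  have : Nonempty (Fin n) := ⟨⟨0, Nat.pos_of_ne_zero hn⟩⟩
  rw [measureReal_def, measureReal_def, Measure.addHaar_ball volume _ hr, ENNReal.toReal_mul,
    finrank_euclideanSpace_fin, ENNReal.toReal_ofReal (by positivity)]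

theorem volume_real_shell_le {n : ℕ} (hn : n ≠ 0) {a h b : ℝ} (ha : 0 ≤ a) (hh : 0 ≤ h)
    (hb : a + h ≤ b) :
    volume.real (ball (0 : EuclideanSpace ℝ (Fin n)) (a + h) \ ball 0 a)
      ≤ volume.real (ball (0 : EuclideanSpace ℝ (Fin n)) 1) * (n * h * b ^ (n - 1)) := by
  rw [measureReal_sdiff (ball_subset_ball (by linarith)) measurableSet_ball
      measure_ball_lt_top.ne,
    volume_real_ball_zero hn ha, volume_real_ball_zero hn (by positivity), ← sub_mul, mul_comm]
  refine mul_le_mul_of_nonneg_left ?_ measureReal_nonneg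
  obtain ⟨k, rfl⟩ := Nat.exists_eq_succ_of_ne_zero hn
  have h1 := pow_sub_pow_le_mul ha (show a ≤ a + h by linarith) k
  have h2 : (a + h) ^ k ≤ b ^ k := by gcongr
  refine h1.trans ?_
  simp only [Nat.succ_eq_add_one, add_sub_cancel_left, Nat.add_sub_cancel]
  push_cast
  gcongr

section energy

variable {n : ℕ} {p m Q lam Lam : ℝ} {Ω : Set (EuclideanSpace ℝ (Fin n))}
  {Efun : EuclideanSpace ℝ (Fin n) → ℝ → EuclideanSpace ℝ (Fin n) → ℝ}
  {u : EuclideanSpace ℝ (Fin n) → ℝ}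

theorem isOpen_ball_inter_lt (hul : LocLipOn Ω u) {r : ℝ} (hr : ball 0 r ⊆ Ω) (a b : ℝ) :
    IsOpen {x | x ∈ ball 0 r ∧ a < u x ∧ u x < b} :=
  (hul.continuousOn.mono hr).isOpen_inter_preimage isOpen_ball isOpen_Ioo

theorem lintegral_gradient_le (hp : 1 < p) (hm : 0 < m) (hQ : 1 ≤ Q) (hlam : 0 < lam)
    (hlL : lam ≤ Lam)
    (hEm : Measurable (fun q : EuclideanSpace ℝ (Fin n) × ℝ × EuclideanSpace ℝ (Fin n) =>
          Efun q.1 q.2.1 q.2.2))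
    (hE : ∀ ξ τ x, τ ∈ Icc (-1 : ℝ) 1 → x ∈ Ω →
          0 ≤ Efun ξ τ x ∧
          lam * (‖ξ‖ ^ p + |τ + 1| ^ m * (if τ ≤ 0 then (1 : ℝ) else 0)) ≤ Efun ξ τ x ∧
          Efun ξ τ x ≤ Lam * (‖ξ‖ ^ p + |τ + 1| ^ m))
    (hu : ∀ x, u x ∈ Icc (-1 : ℝ) 1)
    (hul : LocLipOn Ω u) (hmin : IsQMin Q Ω Efun u) {r s : ℝ} (hs : closedBall 0 s ⊆ Ω)
    (hrs : r ≤ s - 1) :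
    ENNReal.ofReal (lam * (1 / 2) ^ m) *
        ∫⁻ x in {x | x ∈ ball 0 r ∧ -(1 / 2) < u x ∧ u x < 0}, ‖fderiv ℝ u x‖ₑ
      ≤ ENNReal.ofReal (Q * (Lam * (2 ^ p + 2 ^ m))) *
        volume ({x | x ∈ ball 0 s ∧ radialBarrier s x < u x} \ ball 0 (s - 1)) := by
  have hrΩ : ball (0 : EuclideanSpace ℝ (Fin n)) r ⊆ Ω :=
    (ball_subset_closedBall.trans (closedBall_subset_closedBall (by linarith))).trans hs
  refine le_trans ?_ (lintegral_superlevel_radialBarrier_le hp hm hQ hlam hlL hEm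
    (fun ξ τ x hτ hx => ⟨(hE ξ τ x hτ hx).1, (hE ξ τ x hτ hx).2.2⟩) hu hul hmin hs)
  rw [← lintegral_const_mul' _ _ (by simp)]
  have hsub : {x | x ∈ ball 0 r ∧ -(1 / 2) < u x ∧ u x < 0}
      ⊆ {x | x ∈ ball 0 s ∧ radialBarrier s x < u x} := by
    intro x hx
    refine ⟨ball_subset_ball (by linarith) hx.1, ?_⟩
    rw [radialBarrier_of_le_sub_one ((mem_ball_zero_iff.mp hx.1).le.trans hrs)]
    linarith [hx.2.1]
  refine le_trans ?_ (lintegral_mono_set hsub)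
  refine setLIntegral_mono' (isOpen_ball_inter_lt hul hrΩ _ _).measurableSet fun x hx => ?_
  rw [← ofReal_norm, ← ENNReal.ofReal_mul (by positivity), ← norm_gradient]
  refine ENNReal.ofReal_le_ofReal (le_trans ?_ (hE _ _ _ (hu x) (hrΩ hx.1)).2.1)
  rw [if_pos hx.2.2.le, mul_one, mul_assoc]
  refine mul_le_mul_of_nonneg_left ?_ hlam.le
  have h1 : ((1 : ℝ) / 2) ^ m ≤ |u x + 1| ^ m := by
    have := le_abs_self (u x + 1)
    gcongr
    linarith [hx.2.1]
  have h2 : ((1 : ℝ) / 2) ^ m ≤ 1 := Real.rpow_le_one (by norm_num) (by norm_num) hm.le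
  have h0 : (0 : ℝ) ≤ (1 / 2) ^ m := by positivity
  have hg : 0 ≤ ‖gradient u x‖ ^ p := by positivity
  rcases le_total ‖gradient u x‖ 1 with hc | hc
  · nlinarith [norm_nonneg (gradient u x)]
  · have : ‖gradient u x‖ ≤ ‖gradient u x‖ ^ p := by
      simpa using Real.rpow_le_rpow_of_exponent_le hc hp.le
    nlinarith [norm_nonneg (gradient u x)]

theorem volume_intermediate_le (hp : 1 < p) (hm : 0 < m) (hQ : 1 ≤ Q) (hlam : 0 < lam)
    (hlL : lam ≤ Lam)
    (hEm : Measurable (fun q : EuclideanSpace ℝ (Fin n) × ℝ × EuclideanSpace ℝ (Fin n) =>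
          Efun q.1 q.2.1 q.2.2))
    (hE : ∀ ξ τ x, τ ∈ Icc (-1 : ℝ) 1 → x ∈ Ω →
          0 ≤ Efun ξ τ x ∧
          lam * (‖ξ‖ ^ p + |τ + 1| ^ m * (if τ ≤ 0 then (1 : ℝ) else 0)) ≤ Efun ξ τ x ∧
          Efun ξ τ x ≤ Lam * (‖ξ‖ ^ p + |τ + 1| ^ m))
    (hu : ∀ x, u x ∈ Icc (-1 : ℝ) 1)
    (hul : LocLipOn Ω u) (hmin : IsQMin Q Ω Efun u) {r s : ℝ} (hs : closedBall 0 s ⊆ Ω)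
    (hrs : r ≤ s - 1) {η : ℝ} (hη : 0 < η) :
    ENNReal.ofReal (lam * (2 * η) ^ m) *
        volume {x | x ∈ ball 0 r ∧ -1 + 2 * η < u x ∧ u x < 0}
      ≤ ENNReal.ofReal (Q * (Lam * (2 ^ p + 2 ^ m))) *
        volume ({x | x ∈ ball 0 s ∧ radialBarrier s x < u x} \ ball 0 (s - 1)) := by
  have hrΩ : ball (0 : EuclideanSpace ℝ (Fin n)) r ⊆ Ω :=
    (ball_subset_closedBall.trans (closedBall_subset_closedBall (by linarith))).trans hs
  refine le_trans ?_ (lintegral_superlevel_radialBarrier_le hp hm hQ hlam hlL hEm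
    (fun ξ τ x hτ hx => ⟨(hE ξ τ x hτ hx).1, (hE ξ τ x hτ hx).2.2⟩) hu hul hmin hs)
  have hsub : {x | x ∈ ball 0 r ∧ -1 + 2 * η < u x ∧ u x < 0}
      ⊆ {x | x ∈ ball 0 s ∧ radialBarrier s x < u x} := by
    intro x hx
    refine ⟨ball_subset_ball (by linarith) hx.1, ?_⟩
    rw [radialBarrier_of_le_sub_one ((mem_ball_zero_iff.mp hx.1).le.trans hrs)]
    linarith [hx.2.1]
  refine le_trans ?_ (lintegral_mono_set hsub)
  rw [← setLIntegral_const]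
  refine setLIntegral_mono' (isOpen_ball_inter_lt hul hrΩ _ _).measurableSet fun x hx => ?_
  refine ENNReal.ofReal_le_ofReal (le_trans ?_ (hE _ _ _ (hu x) (hrΩ hx.1)).2.1)
  rw [if_pos hx.2.2.le, mul_one]
  refine mul_le_mul_of_nonneg_left ?_ hlam.le
  have h1 : (2 * η) ^ m ≤ |u x + 1| ^ m := by
    have := le_abs_self (u x + 1)
    gcongr
    linarith [hx.2.1]
  have hg : 0 ≤ ‖gradient u x‖ ^ p := by positivity
  linarith

end energy

theorem sum_volume_superlevel_shell_le {n : ℕ} (hn : n ≠ 0) {Ω : Set (EuclideanSpace ℝ (Fin n))}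
    {u : EuclideanSpace ℝ (Fin n) → ℝ} (hul : LocLipOn Ω u) {r : ℝ} (hr : 0 ≤ r)
    (hrΩ : ball 0 (2 * r) ⊆ Ω) {N : ℕ} (hN : N ≤ r - 2) {η : ℝ} (hη : 0 < η) (hη1 : η ≤ 1) :
    ∑ k ∈ Finset.range N, volume.real
        ({x | x ∈ ball (0 : EuclideanSpace ℝ (Fin n)) (r + (k + 1)) ∧
            radialBarrier (r + (k + 1)) x < u x} \ ball 0 (r + (k + 1) - 1))
      ≤ volume.real ({x | 0 ≤ u x} ∩ ball 0 (2 * r))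
        + volume.real {x | x ∈ ball (0 : EuclideanSpace ℝ (Fin n)) (2 * r - 2) ∧
            -1 + 2 * η < u x ∧ u x < 0}
        + N * (volume.real (ball (0 : EuclideanSpace ℝ (Fin n)) 1)
            * (n * η * (2 * r) ^ (n - 1))) := by
  set D : Set (EuclideanSpace ℝ (Fin n)) := {x | x ∈ ball 0 (2 * r - 2) ∧ -1 + 2 * η < u x}
  have hDΩ : ball (0 : EuclideanSpace ℝ (Fin n)) (2 * r - 2) ⊆ Ω :=
    (ball_subset_ball (by linarith)).trans hrΩ
  have hDm : MeasurableSet D :=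
    ((hul.continuousOn.mono hDΩ).isOpen_inter_preimage isOpen_ball isOpen_Ioi).measurableSet
  set Sh : ℕ → Set (EuclideanSpace ℝ (Fin n)) := fun k =>
    ball 0 (r + (k + 1)) \ ball 0 (r + (k + 1) - 1)
  have hShm : ∀ k, MeasurableSet (Sh k) := fun k => measurableSet_ball.diff measurableSet_ball
  have hfin : ∀ {s : Set (EuclideanSpace ℝ (Fin n))} {a : ℝ}, s ⊆ ball 0 a → volume s ≠ ⊤ :=
    fun h => ((measure_mono h).trans_lt measure_ball_lt_top).ne
  have hDfin : volume D ≠ ⊤ := hfin (a := 2 * r - 2) fun x hx => hx.1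
  have hdisj : Pairwise (Function.onFun Disjoint fun k => D ∩ Sh k) := by
    have key : ∀ i j : ℕ, i < j → Disjoint (D ∩ Sh i) (D ∩ Sh j) := by
      intro i j hij
      refine disjoint_left.mpr fun x hi hj => hj.2.2 ?_
      have h1 := hi.2.1
      rw [mem_ball_zero_iff] at h1 ⊢
      have : (i : ℝ) + 1 ≤ j := by exact_mod_cast hij
      linarith
    intro i j hij
    rcases lt_or_gt_of_ne hij with h | h
    · exact key i j h
    · exact (key j i h).symm
  have hstep : ∀ k ∈ Finset.range N, volume.real
        ({x | x ∈ ball (0 : EuclideanSpace ℝ (Fin n)) (r + (k + 1)) ∧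
            radialBarrier (r + (k + 1)) x < u x} \ ball 0 (r + (k + 1) - 1))
      ≤ volume.real (D ∩ Sh k) + volume.real (ball (0 : EuclideanSpace ℝ (Fin n)) 1)
            * (n * η * (2 * r) ^ (n - 1)) := by
    intro k hk
    have hkN : (k : ℝ) + 1 ≤ N := by exact_mod_cast Finset.mem_range.mp hk
    have hk0 : (0 : ℝ) ≤ k := k.cast_nonneg
    have hshell := volume_real_shell_le hn (a := r + k) (h := η) (b := 2 * r)
      (by positivity) hη.le (by linarith)
    refine le_trans ?_ (add_le_add_right hshell _)
    refine le_trans (measureReal_mono ?_ ?_) (measureReal_union_le _ _)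
    · intro x hx
      have hx1 := mem_ball_zero_iff.mp hx.1.1
      have hx2 : r + (k + 1) - 1 ≤ ‖x‖ := by simpa using hx.2
      by_cases hc : -1 + 2 * η < u x
      · exact Or.inl ⟨⟨mem_ball_zero_iff.mpr (by linarith), hc⟩, hx.1.1, hx.2⟩
      · refine Or.inr ⟨mem_ball_zero_iff.mpr ?_, fun h => ?_⟩
        · have hb := hx.1.2
          rw [radialBarrier, min_eq_right (by linarith), max_eq_right (by linarith)] at hb
          linarith [not_lt.mp hc]
        · linarith [mem_ball_zero_iff.mp h]
    · exact (measure_union_lt_top (hfin (a := 2 * r - 2) fun x hx => hx.1.1).lt_top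
        (hfin sdiff_subset).lt_top).ne
  refine (Finset.sum_le_sum hstep).trans ?_
  rw [Finset.sum_add_distrib, Finset.sum_const, Finset.card_range, nsmul_eq_mul]
  gcongr
  rw [← measureReal_biUnion_finset (fun i _ j _ hij => hdisj hij)
    (fun k _ => hDm.inter (hShm k)) (fun k _ => ((measure_mono inter_subset_left).trans_lt
      hDfin.lt_top).ne)]
  refine le_trans (measureReal_mono ?_ ?_) (measureReal_union_le _ _)
  · intro x hx
    simp only [mem_iUnion] at hx
    obtain ⟨k, -, hx, -⟩ := hx
    by_cases hc : 0 ≤ u x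
    · exact Or.inl ⟨hc, ball_subset_ball (by linarith) hx.1⟩
    · exact Or.inr ⟨hx.1, hx.2, not_le.mp hc⟩
  · exact (measure_union_lt_top (hfin inter_subset_right).lt_top
      (hfin (a := 2 * r - 2) fun x hx => hx.1).lt_top).ne

theorem density_doubling
    {n : ℕ} (hn : n ≠ 0) {p m Q lam Lam : ℝ}
    (hp : 1 < p) (hm : 0 < m) (hQ : 1 ≤ Q) (hlam : 0 < lam) (hlL : lam ≤ Lam) :
    ∃ δ₀ > (0 : ℝ), ∀ δ > (0 : ℝ), δ ≤ δ₀ → ∃ ρ₀ > (0 : ℝ),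
      ∀ Ω : Set (EuclideanSpace ℝ (Fin n)),
      ∀ Efun : EuclideanSpace ℝ (Fin n) → ℝ → EuclideanSpace ℝ (Fin n) → ℝ,
        Measurable (fun q : EuclideanSpace ℝ (Fin n) × ℝ × EuclideanSpace ℝ (Fin n) =>
          Efun q.1 q.2.1 q.2.2) →
        (∀ ξ τ x, τ ∈ Icc (-1 : ℝ) 1 → x ∈ Ω →
          0 ≤ Efun ξ τ x ∧
          lam * (‖ξ‖ ^ p + |τ + 1| ^ m * (if τ ≤ 0 then (1 : ℝ) else 0)) ≤ Efun ξ τ x ∧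
          Efun ξ τ x ≤ Lam * (‖ξ‖ ^ p + |τ + 1| ^ m)) →
        ∀ u : EuclideanSpace ℝ (Fin n) → ℝ,
          (∀ x, u x ∈ Icc (-1 : ℝ) 1) → LocLipOn Ω u → IsQMin Q Ω Efun u →
          ∀ r : ℝ, ρ₀ ≤ r → ball (0 : EuclideanSpace ℝ (Fin n)) (2 * r) ⊆ Ω →
            δ * r ^ n ≤ volume.real ({x | 0 ≤ u x} ∩ ball 0 r) →
              δ * (2 * r) ^ n ≤ volume.real ({x | 0 ≤ u x} ∩ ball 0 (2 * r)) := by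
  have hLam : 0 < Lam := hlam.trans_le hlL
  set ω : ℝ := volume.real (ball (0 : EuclideanSpace ℝ (Fin n)) 1) with hω
  have hω0 : 0 < ω :=
    ENNReal.toReal_pos (measure_ball_pos volume 0 one_pos).ne' measure_ball_lt_top.ne
  set C : ℝ := Q * (Lam * (2 ^ p + 2 ^ m)) with hC
  have hC0 : 0 < C := by positivity
  set c : ℝ := lam * (1 / 2) ^ m with hc
  have hc0 : 0 < c := by positivity
  set τ : ℝ := min 1 (c / (4 * (C * ((2 ^ n + 2) * 2 ^ (n + 2))))) with hτ
  have hτ0 : 0 < τ := lt_min one_pos (by positivity)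
  have hτ1 : τ ≤ 1 := min_le_left _ _
  have hτc : C * ((2 ^ n + 2) * 2 ^ (n + 2)) * τ ≤ c / 4 := by
    have := (le_div_iff₀ (by positivity)).mp (min_le_right 1
      (c / (4 * (C * ((2 ^ n + 2) * 2 ^ (n + 2))))))
    rw [← hτ] at this
    linarith
  refine ⟨ω * (τ / 2) ^ n / (2 * (2 ^ n + 1)), by positivity, fun δ hδ hδ₀ => ?_⟩
  have hδω : (2 ^ n + 1) * δ ≤ ω * (τ / 2) ^ n / 2 := by
    have := (le_div_iff₀ (by positivity)).mp hδ₀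
    linarith
  have hn0 : (0 : ℝ) < n := by exact_mod_cast Nat.pos_of_ne_zero hn
  set η : ℝ := min (1 / 4) (δ / (ω * n * 2 ^ (n - 1))) with hη
  have hη0 : 0 < η := lt_min (by norm_num) (by positivity)
  have hη4 : η ≤ 1 / 4 := min_le_left _ _
  have hηδ : ω * n * 2 ^ (n - 1) * η ≤ δ := by
    have := (le_div_iff₀ (by positivity)).mp (min_le_right (1 / 4) (δ / (ω * n * 2 ^ (n - 1))))
    rw [← hη] at this
    linarith
  set κ : ℝ := lam * (2 * η) ^ m with hκ
  have hκ0 : 0 < κ := by positivity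
  refine ⟨max 6 (C * (ω * (n * 2 ^ (n - 1))) / (κ * δ)), by positivity, ?_⟩
  intro Ω Efun hEm hE u hu hul hmin r hr hrΩ hV
  have hr6 : 6 ≤ r := (le_max_left _ _).trans hr
  have hr0 : 0 < r := by linarith
  have hrκ : C * (ω * (n * 2 ^ (n - 1))) ≤ κ * δ * r := by
    have := (div_le_iff₀ (by positivity)).mp ((le_max_right _ _).trans hr)
    linarith
  have hrn : r ^ n = r * r ^ (n - 1) := by
    rw [← pow_succ', Nat.sub_add_cancel (Nat.pos_of_ne_zero hn)]
  have hfin : ∀ {s : Set (EuclideanSpace ℝ (Fin n))} {a : ℝ}, s ⊆ ball 0 a → volume s ≠ ⊤ :=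
    fun h => ((measure_mono h).trans_lt measure_ball_lt_top).ne
  have hclosed : ∀ s : ℝ, s < 2 * r → closedBall (0 : EuclideanSpace ℝ (Fin n)) s ⊆ Ω :=
    fun s hs => (closedBall_subset_ball hs).trans hrΩ
  by_contra! hcon
  set V₁ := volume.real ({x | 0 ≤ u x} ∩ ball (0 : EuclideanSpace ℝ (Fin n)) r) with hV₁
  set V₂ := volume.real ({x | 0 ≤ u x} ∩ ball (0 : EuclideanSpace ℝ (Fin n)) (2 * r)) with hV₂
  set G : Set (EuclideanSpace ℝ (Fin n)) :=
    {x | x ∈ ball 0 (2 * r - 2) ∧ -1 + 2 * η < u x ∧ u x < 0} with hG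
  have hGfin : volume G ≠ ⊤ := hfin (a := 2 * r - 2) fun x hx => hx.1
  rw [mul_pow] at hcon
  -- the set of intermediate values has small volume
  have hγ : volume.real G ≤ δ * r ^ n := by
    have h1 := volume_intermediate_le hp hm hQ hlam hlL hEm hE hu hul hmin
      (hclosed (2 * r - 1) (by linarith)) (show 2 * r - 2 ≤ 2 * r - 1 - 1 by linarith) hη0
    have h2 := ENNReal.toReal_mono (ENNReal.mul_ne_top ENNReal.ofReal_ne_top
      (hfin (a := 2 * r - 1) fun x hx => hx.1.1)) h1
    rw [ENNReal.toReal_mul, ENNReal.toReal_mul, ENNReal.toReal_ofReal hκ0.le,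
      ENNReal.toReal_ofReal hC0.le] at h2
    have h3 := volume_real_shell_le hn (a := 2 * r - 2) (h := 1) (b := 2 * r) (by linarith)
      zero_le_one (by linarith)
    have h4 : (volume ({x | x ∈ ball (0 : EuclideanSpace ℝ (Fin n)) (2 * r - 1) ∧
        radialBarrier (2 * r - 1) x < u x} \ ball 0 (2 * r - 1 - 1))).toReal
        ≤ volume.real (ball (0 : EuclideanSpace ℝ (Fin n)) (2 * r - 2 + 1)
            \ ball 0 (2 * r - 2)) := by
      refine measureReal_mono (fun x hx => ⟨?_, ?_⟩) (hfin sdiff_subset)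
      · convert! hx.1.1 using 2; ring
      · convert! hx.2 using 3; ring
    have h5 := h2.trans (mul_le_mul_of_nonneg_left (h4.trans h3) hC0.le)
    rw [mul_pow] at h5
    have h6 : κ * volume.real G ≤ κ * (δ * r ^ n) := by
      calc κ * volume.real G ≤ C * (ω * (n * 1 * (2 ^ (n - 1) * r ^ (n - 1)))) := h5
        _ = C * (ω * (n * 2 ^ (n - 1))) * r ^ (n - 1) := by ring
        _ ≤ κ * δ * r * r ^ (n - 1) := by gcongr
        _ = κ * (δ * r ^ n) := by rw [hrn]; ring
    exact le_of_mul_le_mul_left h6 hκ0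
  set I : ENNReal := ∫⁻ x in {x | x ∈ ball (0 : EuclideanSpace ℝ (Fin n)) r ∧
    -(1 / 2) < u x ∧ u x < 0}, ‖fderiv ℝ u x‖ₑ with hI
  -- each barrier bounds the gradient integral by the volume of a shell
  have hshell : ∀ s : ℝ, r + 1 ≤ s → s < 2 * r → I ≠ ⊤ ∧ c * I.toReal ≤ C * volume.real
      ({x | x ∈ ball (0 : EuclideanSpace ℝ (Fin n)) s ∧ radialBarrier s x < u x}
        \ ball 0 (s - 1)) := by
    intro s hs1 hs2
    have h1 := lintegral_gradient_le hp hm hQ hlam hlL hEm hE hu hul hmin (hclosed s hs2)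
      (show r ≤ s - 1 by linarith)
    have htop := ENNReal.mul_ne_top (ENNReal.ofReal_ne_top (r := C))
      (hfin (s := {x | x ∈ ball (0 : EuclideanSpace ℝ (Fin n)) s ∧ radialBarrier s x < u x}
        \ ball 0 (s - 1)) (a := s) fun x hx => hx.1.1)
    refine ⟨fun hItop => ?_, ?_⟩
    · rw [← hI, hItop, ENNReal.mul_top (ENNReal.ofReal_pos.mpr hc0).ne'] at h1
      exact htop (top_le_iff.mp h1)
    · have h2 := ENNReal.toReal_mono htop h1
      rwa [ENNReal.toReal_mul, ENNReal.toReal_mul, ENNReal.toReal_ofReal hc0.le,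
        ENNReal.toReal_ofReal hC0.le] at h2
  have hItop : I ≠ ⊤ := (hshell (r + 1) le_rfl (by linarith)).1
  -- isoperimetric inequality at scale `τ * r`
  have hiso : δ * r ^ n ≤ 2 ^ (n + 2) * τ * r * I.toReal := by
    have hτr : 0 < τ * r := by positivity
    have h1 := hul.relative_isoperimetric_ball (hclosed r (by linarith)) hτr
      (mul_le_of_le_one_left hr0.le hτ1)
    rw [← hI] at h1
    have hP : {x | x ∈ ball (0 : EuclideanSpace ℝ (Fin n)) r ∧ 0 ≤ u x}
        = {x | 0 ≤ u x} ∩ ball 0 r := by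
      ext x; exact and_comm
    have h2 := ENNReal.toReal_mono (ENNReal.mul_ne_top
      (ENNReal.mul_ne_top ENNReal.ofReal_ne_top hItop) measure_ball_lt_top.ne) h1
    simp only [ENNReal.toReal_mul] at h2
    rw [hP, ENNReal.toReal_ofReal (by norm_num), ENNReal.toReal_ofReal hτr.le] at h2
    have h3 := ENNReal.le_toReal_sub
      (a := volume (ball (0 : EuclideanSpace ℝ (Fin n)) (τ * r / 2)))
      (hfin (s := {x | x ∈ ball (0 : EuclideanSpace ℝ (Fin n)) r ∧ -(1 / 2) < u x}) (a := r)
        fun x hx => hx.1)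
    have h4 : (volume (ball (0 : EuclideanSpace ℝ (Fin n)) (τ * r / 2))).toReal
        = (τ / 2) ^ n * r ^ n * ω := by
      rw [← measureReal_def, volume_real_ball_zero hn (by positivity), ← mul_pow]
      congr 2; ring
    have h5 : (volume (ball (0 : EuclideanSpace ℝ (Fin n)) (τ * r))).toReal
        = τ ^ n * r ^ n * ω := by
      rw [← measureReal_def, volume_real_ball_zero hn (by positivity), ← mul_pow]
    have h6 : (volume {x | x ∈ ball (0 : EuclideanSpace ℝ (Fin n)) r ∧ -(1 / 2) < u x}).toReal
        ≤ (2 ^ n + 1) * δ * r ^ n := by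
      have : volume.real {x | x ∈ ball (0 : EuclideanSpace ℝ (Fin n)) r ∧ -(1 / 2) < u x}
          ≤ V₂ + volume.real G := by
        refine le_trans (measureReal_mono (fun x hx => ?_) ?_) (measureReal_union_le _ _)
        · by_cases h0 : 0 ≤ u x
          · exact Or.inl ⟨h0, ball_subset_ball (by linarith) hx.1⟩
          · exact Or.inr ⟨ball_subset_ball (by linarith) hx.1, by linarith [hx.2], not_le.mp h0⟩
        · exact (measure_union_lt_top (hfin inter_subset_right).lt_top hGfin.lt_top).ne
      rw [measureReal_def] at this
      linarith
    have h7 : (2 ^ n + 1) * δ * r ^ n ≤ ω * (τ / 2) ^ n / 2 * r ^ n := by gcongr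
    have h8 : ω * (τ / 2) ^ n / 2 * r ^ n
        ≤ (volume (ball (0 : EuclideanSpace ℝ (Fin n)) (τ * r / 2))
          - volume {x | x ∈ ball (0 : EuclideanSpace ℝ (Fin n)) r ∧ -(1 / 2) < u x}).toReal := by
      linarith
    have h9 : 1 / 2 * (δ * r ^ n * (ω * (τ / 2) ^ n / 2 * r ^ n))
        ≤ τ * r * I.toReal * (τ ^ n * r ^ n * ω) := by
      rw [← h5]
      refine le_trans ?_ h2
      gcongr
      exact hV
    have h10 : ω * τ ^ n * r ^ n / 2 ^ (n + 2) * (δ * r ^ n)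
        ≤ ω * τ ^ n * r ^ n / 2 ^ (n + 2) * (2 ^ (n + 2) * τ * r * I.toReal) := by
      calc ω * τ ^ n * r ^ n / 2 ^ (n + 2) * (δ * r ^ n)
          = 1 / 2 * (δ * r ^ n * (ω * (τ / 2) ^ n / 2 * r ^ n)) := by
            rw [div_pow, pow_add]; field_simp
        _ ≤ _ := h9
        _ = _ := by field_simp
    exact le_of_mul_le_mul_left h10 (by positivity)
  -- sum over the barriers at radii `r + 1, …, r + N`
  set N : ℕ := ⌊r - 2⌋₊ with hN
  have hN1 : (N : ℝ) ≤ r - 2 := Nat.floor_le (by linarith)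
  have hN2 : r / 2 ≤ N := by
    have := Nat.lt_floor_add_one (r - 2)
    rw [← hN] at this
    linarith
  have hsum := sum_volume_superlevel_shell_le hn hul hr0.le hrΩ hN1 hη0 (by linarith)
  have hlow : N * (c * I.toReal) ≤ C * ∑ k ∈ Finset.range N, volume.real
        ({x | x ∈ ball (0 : EuclideanSpace ℝ (Fin n)) (r + (k + 1)) ∧
            radialBarrier (r + (k + 1)) x < u x} \ ball 0 (r + (k + 1) - 1)) := by
    rw [Finset.mul_sum, ← nsmul_eq_mul]
    nth_rewrite 1 [← Finset.card_range N]
    refine Finset.card_nsmul_le_sum _ _ _ fun k hk => ?_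
    have hkN : (k : ℝ) + 1 ≤ N := by exact_mod_cast Finset.mem_range.mp hk
    have hk0 : (0 : ℝ) ≤ k := k.cast_nonneg
    exact (hshell _ (by linarith) (by linarith)).2
  have hthin : N * (ω * (n * η * (2 * r) ^ (n - 1))) ≤ δ * r ^ n := by
    calc N * (ω * (n * η * (2 * r) ^ (n - 1)))
        ≤ r * (ω * (n * η * (2 * r) ^ (n - 1))) := by gcongr; linarith
      _ = ω * n * 2 ^ (n - 1) * η * r ^ n := by rw [mul_pow, hrn]; ring
      _ ≤ δ * r ^ n := by gcongr
  have hδr : 0 < δ * r ^ n := by positivity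
  have hIr : 0 < r * I.toReal := by
    have : 0 < 2 ^ (n + 2) * τ * (r * I.toReal) := by linarith
    exact pos_of_mul_pos_right this (by positivity)
  have hfinal : r / 2 * (c * I.toReal) ≤ c / 4 * (r * I.toReal) := by
    calc r / 2 * (c * I.toReal) ≤ N * (c * I.toReal) := by gcongr
      _ ≤ C * ((2 ^ n + 2) * (δ * r ^ n)) := by
          refine hlow.trans (mul_le_mul_of_nonneg_left ?_ hC0.le)
          refine hsum.trans ?_
          linarith
      _ ≤ C * ((2 ^ n + 2) * (2 ^ (n + 2) * τ * r * I.toReal)) := by gcongr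
      _ = C * ((2 ^ n + 2) * 2 ^ (n + 2)) * τ * (r * I.toReal) := by ring
      _ ≤ c / 4 * (r * I.toReal) := by gcongr
  have := mul_pos hc0 hIr
  linarith

/-- Density estimate for Q-minimizers of degenerate Ginzburg–Landau energies
(Theorem 1.2 in the paper). -/
theorem density_estimate_Qminimizers
    (n : ℕ) (hn : 2 ≤ n) (p m Q lam Lam : ℝ)
    (hp : 1 < p) (hpm : p < m) (hQ : 1 ≤ Q) (hlam : 0 < lam) (hlL : lam ≤ Lam)
    (ε : ℝ) (hε : 0 < ε) :
    ∃ ρ₀ > (0 : ℝ), ∃ δ > (0 : ℝ),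
      ∀ Ω : Set (EuclideanSpace ℝ (Fin n)), IsOpen Ω →
      ∀ Efun : EuclideanSpace ℝ (Fin n) → ℝ → EuclideanSpace ℝ (Fin n) → ℝ,
        Measurable (fun q : EuclideanSpace ℝ (Fin n) × ℝ × EuclideanSpace ℝ (Fin n) =>
          Efun q.1 q.2.1 q.2.2) →
        (∀ ξ τ x, τ ∈ Icc (-1 : ℝ) 1 → x ∈ Ω →
          0 ≤ Efun ξ τ x ∧
          lam * (‖ξ‖ ^ p + |τ + 1| ^ m * (if τ ≤ 0 then (1 : ℝ) else 0)) ≤ Efun ξ τ x ∧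
          Efun ξ τ x ≤ Lam * (‖ξ‖ ^ p + |τ + 1| ^ m)) →
        ∀ u : EuclideanSpace ℝ (Fin n) → ℝ,
          (∀ x, u x ∈ Icc (-1 : ℝ) 1) → LocLipOn Ω u → IsQMin Q Ω Efun u →
          ∀ ρ : ℝ, ρ₀ ≤ ρ → ball (0 : EuclideanSpace ℝ (Fin n)) ρ ⊆ Ω →
            ENNReal.ofReal (ε * ρ ^ n) ≤ volume ({x | 0 ≤ u x} ∩ ball 0 ρ) →
            ∀ R : ℝ, ρ ≤ R → ball (0 : EuclideanSpace ℝ (Fin n)) R ⊆ Ω →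
              ENNReal.ofReal (δ * R ^ n) ≤ volume ({x | 0 ≤ u x} ∩ ball 0 R) := by
  obtain ⟨δ₀, hδ₀, hdbl⟩ := density_doubling (n := n) (by omega) hp (by linarith : 0 < m) hQ
    hlam hlL
  set δ : ℝ := min ε δ₀ with hδ
  have hδ0 : 0 < δ := lt_min hε hδ₀
  obtain ⟨ρ₀, hρ₀, hstep⟩ := hdbl δ hδ0 (min_le_right _ _)
  refine ⟨ρ₀, hρ₀, δ / 2 ^ n, by positivity, ?_⟩
  intro Ω _ Efun hEm hE u hu hul hmin ρ hρ _ hvol R hρR hRΩ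
  have hρ0 : 0 < ρ := hρ₀.trans_le hρ
  have hfin : ∀ a : ℝ, volume ({x | 0 ≤ u x} ∩ ball (0 : EuclideanSpace ℝ (Fin n)) a) ≠ ⊤ :=
    fun a => ((measure_mono inter_subset_right).trans_lt measure_ball_lt_top).ne
  have hpow : ∀ k : ℕ, 2 ^ k * ρ ≤ R →
      δ * (2 ^ k * ρ) ^ n
        ≤ volume.real ({x | 0 ≤ u x} ∩ ball (0 : EuclideanSpace ℝ (Fin n)) (2 ^ k * ρ)) := by
    intro k
    induction k with
    | zero =>
      intro _
      rw [pow_zero, one_mul, measureReal_def]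
      refine le_trans ?_ ((ENNReal.ofReal_le_iff_le_toReal (hfin ρ)).mp hvol)
      gcongr
      exact min_le_left _ _
    | succ k ih =>
      intro hk
      have h2 : (2 : ℝ) ^ (k + 1) * ρ = 2 * (2 ^ k * ρ) := by ring
      have hk0 : 0 < 2 ^ k * ρ := by positivity
      rw [h2] at hk ⊢
      refine hstep Ω Efun hEm hE u hu hul hmin _ ?_ ((ball_subset_ball hk).trans hRΩ)
        (ih (by linarith))
      exact hρ.trans (le_mul_of_one_le_left hρ0.le (one_le_pow₀ one_le_two))
  obtain ⟨k, hk1, hk2⟩ := exists_nat_pow_near ((one_le_div hρ0).mpr hρR) one_lt_two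
  rw [le_div_iff₀ hρ0] at hk1
  rw [div_lt_iff₀ hρ0] at hk2
  rw [ENNReal.ofReal_le_iff_le_toReal (hfin R)]
  calc δ / 2 ^ n * R ^ n ≤ δ / 2 ^ n * (2 ^ (k + 1) * ρ) ^ n := by
        have hR0 : 0 ≤ R := hρ0.le.trans hρR
        gcongr
    _ = δ * (2 ^ k * ρ) ^ n := by
        rw [show (2 : ℝ) ^ (k + 1) * ρ = 2 * (2 ^ k * ρ) by ring, mul_pow 2]
        field_simp
    _ ≤ _ := hpow k hk1
    _ ≤ _ := measureReal_mono (inter_subset_inter_right _ (ball_subset_ball hk1)) (hfin R)
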